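/- Let h_r(u) = u Φ(ru) + r^{−1} φ(ru) for r > 0, where Φ and φ are the standard normal distribution function and density. Then h_r converges uniformly on ℝ to the positive-part function u ↦ u⁺ = max(u,0) as r → ∞; that is, sup_{u ∈ ℝ} |h_r(u) − u⁺| → 0 as r → ∞. -/

import Mathlib

open Filter Real MeasureTheory Set

noncomputable section

/-- The standard normal density `φ(x) = (2π)^{−1/2} e^{−x²/2}`. -/
def stdNormalPDF (x : ℝ) : ℝ := (Real.sqrt (2 * Real.pi))⁻¹ * Real.exp (-x ^ 2 / 2)

/-- The standard normal distribution function `Φ(x) = ∫_{−∞}^x φ(v) dv`. -/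
def stdNormalCDF (x : ℝ) : ℝ := ∫ v in Set.Iic x, stdNormalPDF v

/-- The smooth approximation `h_r(u) = u Φ(ru) + r⁻¹ φ(ru)` to the positive part. -/
def smoothPos (r u : ℝ) : ℝ := u * stdNormalCDF (r * u) + r⁻¹ * stdNormalPDF (r * u)

lemma stdNormalPDF_eq_gaussianPDFReal :
    stdNormalPDF = ProbabilityTheory.gaussianPDFReal 0 1 := by
  ext x
  simp [stdNormalPDF, ProbabilityTheory.gaussianPDFReal]

lemma integrable_stdNormalPDF : Integrable stdNormalPDF := by
  rw [stdNormalPDF_eq_gaussianPDFReal]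
  exact ProbabilityTheory.integrable_gaussianPDFReal 0 1

lemma integral_stdNormalPDF : ∫ v, stdNormalPDF v = 1 := by
  rw [stdNormalPDF_eq_gaussianPDFReal]
  exact ProbabilityTheory.integral_gaussianPDFReal_eq_one 0 one_ne_zero

lemma stdNormalPDF_nonneg (x : ℝ) : 0 ≤ stdNormalPDF x := by
  unfold stdNormalPDF
  positivity

lemma stdNormalPDF_neg (x : ℝ) : stdNormalPDF (-x) = stdNormalPDF x := by
  simp [stdNormalPDF]

lemma stdNormalPDF_le_one (x : ℝ) : stdNormalPDF x ≤ 1 := by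
  unfold stdNormalPDF
  refine mul_le_one₀ (inv_le_one_of_one_le₀ ?_) (exp_pos _).le (exp_le_one_iff.2 ?_)
  · exact Real.one_le_sqrt.2 (by linarith [Real.pi_gt_three])
  · nlinarith [sq_nonneg x]

lemma hasDerivAt_stdNormalPDF (x : ℝ) :
    HasDerivAt stdNormalPDF (-(x * stdNormalPDF x)) x := by
  have h : HasDerivAt (fun y : ℝ => -y ^ 2 / 2) (-x) x :=
    (((hasDerivAt_pow 2 x).neg).div_const 2).congr_deriv (by norm_num; ring)
  exact ((h.exp).const_mul _).congr_deriv (by unfold stdNormalPDF; ring)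

lemma tendsto_stdNormalPDF_atTop : Tendsto stdNormalPDF atTop (nhds 0) := by
  have h : Tendsto (fun x : ℝ => -x ^ 2 / 2) atTop atBot := by
    have := tendsto_neg_atTop_atBot.comp
      ((tendsto_pow_atTop (α := ℝ) two_ne_zero).atTop_div_const (zero_lt_two' ℝ))
    exact this.congr fun x => by simp only [Function.comp_apply]; ring
  have hlim := (tendsto_exp_atBot.comp h).const_mul (Real.sqrt (2 * Real.pi))⁻¹
  rw [mul_zero] at hlim
  exact hlim

/-- Gaussian tail (Mills ratio) bound. -/
lemma mul_integral_Ioi_stdNormalPDF_le {x : ℝ} (hx : 0 ≤ x) :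
    x * ∫ v in Ioi x, stdNormalPDF v ≤ stdNormalPDF x := by
  have hd : ∀ y ∈ Ici x, HasDerivAt (fun z => -stdNormalPDF z) (y * stdNormalPDF y) y :=
    fun y _ => (hasDerivAt_stdNormalPDF y).neg.congr_deriv (neg_neg _)
  have hpos : ∀ y ∈ Ioi x, 0 ≤ y * stdNormalPDF y :=
    fun y hy => mul_nonneg (hx.trans (le_of_lt hy)) (stdNormalPDF_nonneg y)
  have hlim : Tendsto (fun z => -stdNormalPDF z) atTop (nhds 0) := by
    simpa using tendsto_stdNormalPDF_atTop.neg
  have hint := integrableOn_Ioi_deriv_of_nonneg' hd hpos hlim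
  have heq := integral_Ioi_of_hasDerivAt_of_nonneg' hd hpos hlim
  calc x * ∫ v in Ioi x, stdNormalPDF v = ∫ v in Ioi x, x * stdNormalPDF v :=
        (integral_const_mul _ _).symm
    _ ≤ ∫ v in Ioi x, v * stdNormalPDF v :=
        setIntegral_mono_on (integrable_stdNormalPDF.const_mul x).integrableOn hint
          measurableSet_Ioi fun y hy =>
            mul_le_mul_of_nonneg_right (le_of_lt hy) (stdNormalPDF_nonneg y)
    _ = stdNormalPDF x := by rw [heq]; ring

lemma integral_Ioi_stdNormalPDF_nonneg (x : ℝ) : 0 ≤ ∫ v in Ioi x, stdNormalPDF v :=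
  integral_nonneg fun v => stdNormalPDF_nonneg v

lemma stdNormalCDF_add_integral_Ioi (x : ℝ) :
    stdNormalCDF x + ∫ v in Ioi x, stdNormalPDF v = 1 := by
  rw [stdNormalCDF, intervalIntegral.integral_Iic_add_Ioi integrable_stdNormalPDF.integrableOn
    integrable_stdNormalPDF.integrableOn, integral_stdNormalPDF]

lemma stdNormalCDF_eq_integral_Ioi_neg (x : ℝ) :
    stdNormalCDF x = ∫ v in Ioi (-x), stdNormalPDF v := by
  rw [stdNormalCDF, ← integral_comp_neg_Iic]
  simp only [stdNormalPDF_neg]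

lemma abs_mul_stdNormalCDF_add_stdNormalPDF_sub_le_one (x : ℝ) :
    |x * stdNormalCDF x + stdNormalPDF x - max x 0| ≤ 1 := by
  have h1 := stdNormalPDF_le_one x
  rcases le_total 0 x with hx | hx
  · have h := mul_integral_Ioi_stdNormalPDF_le hx
    have h' := mul_nonneg hx (integral_Ioi_stdNormalPDF_nonneg x)
    rw [max_eq_left hx, eq_sub_of_add_eq (stdNormalCDF_add_integral_Ioi x), abs_le]
    constructor <;> linarith
  · have hx' := neg_nonneg.2 hx
    have h := mul_integral_Ioi_stdNormalPDF_le hx'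
    have h' := mul_nonneg hx' (integral_Ioi_stdNormalPDF_nonneg (-x))
    rw [stdNormalPDF_neg] at h
    rw [max_eq_right hx, stdNormalCDF_eq_integral_Ioi_neg, abs_le]
    constructor <;> linarith

lemma abs_smoothPos_sub_posPart_le {r : ℝ} (hr : 0 < r) (u : ℝ) :
    |smoothPos r u - max u 0| ≤ r⁻¹ := by
  have hmax : max (r * u) 0 = r * max u 0 := by
    rw [mul_max_of_nonneg _ _ hr.le, mul_zero]
  have h : smoothPos r u - max u 0 =
      r⁻¹ * (r * u * stdNormalCDF (r * u) + stdNormalPDF (r * u) - max (r * u) 0) := by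
    rw [hmax, smoothPos]
    field_simp
  rw [h, abs_mul, abs_of_pos (inv_pos.2 hr)]
  exact mul_le_of_le_one_right (inv_pos.2 hr).le
    (abs_mul_stdNormalCDF_add_stdNormalPDF_sub_le_one _)

/-- **Uniform convergence of the smoothed positive part.**
`h_r` converges uniformly on `ℝ` to `u ↦ u⁺ = max(u,0)` as `r → ∞`:
`sup_{u ∈ ℝ} |h_r(u) − u⁺| → 0`. -/
theorem smoothPos_tendsto_posPart_uniformly :
    Tendsto (fun r : ℝ => ⨆ u : ℝ, |smoothPos r u - max u 0|) atTop (nhds 0) := by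
  refine tendsto_of_tendsto_of_tendsto_of_le_of_le' tendsto_const_nhds tendsto_inv_atTop_zero
    (Eventually.of_forall fun r => Real.iSup_nonneg fun u => abs_nonneg _) ?_
  filter_upwards [eventually_gt_atTop 0] with r hr
  exact ciSup_le (abs_smoothPos_sub_posPart_le hr)

end
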